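/- arXiv:1702.01279 — 3 statements merged into one kernel-verified Lean document; each statement's English description precedes it below -/
import Mathlib

section
/- Let N ≥ 2 be an integer and k ≥ 0 an integer. Define, for α ∈ (0,1), d_{N,α} = (1−α) Γ((N+1)/2) / ((N−1) π^((N−1)/2)) and λ_k(α) = (π^((N−1)/2) Γ((1−α)/2) / ((1+α) 2^α Γ((N+α)/2))) · ( Γ((2k+N+α)/2)/Γ((2k+N−α−2)/2) − Γ((N+α)/2)/Γ((N−α−2)/2) ). Then lim_{α → 1⁻} 2 d_{N,α} λ_k(α) = k(k+N−2)/(N−1). -/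
open Filter

theorem Real.continuous_inv_Gamma : Continuous fun s : ℝ => (Real.Gamma s)⁻¹ := by
  have h : Continuous fun s : ℝ => ((Complex.Gamma (s : ℂ))⁻¹).re :=
    Complex.continuous_re.comp
      (Complex.differentiable_one_div_Gamma.continuous.comp Complex.continuous_ofReal)
  refine h.congr fun s => ?_
  rw [Complex.Gamma_ofReal, ← Complex.ofReal_inv, Complex.ofReal_re]

theorem Real.continuousAt_Gamma_of_pos {s : ℝ} (hs : 0 < s) : ContinuousAt Real.Gamma s :=
  (Real.differentiableOn_Gamma_Ioi.differentiableAt (Ioi_mem_nhds hs)).continuousAt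

theorem Real.Gamma_add_two_div_Gamma {x : ℝ} (hx : -1 < x) :
    Real.Gamma (x + 2) / Real.Gamma x = (x + 1) * x := by
  rcases eq_or_ne x 0 with rfl | h0
  · simp
  have h1 : x + 1 ≠ 0 := by linarith
  have h2 : Real.Gamma x ≠ 0 := by
    refine Real.Gamma_ne_zero fun m hm => ?_
    rcases m with _ | m
    · simp at hm
      exact h0 hm
    · push_cast at hm
      have : (0 : ℝ) ≤ m := m.cast_nonneg
      linarith
  rw [show x + 2 = x + 1 + 1 by ring, Real.Gamma_add_one h1, Real.Gamma_add_one h0]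
  field_simp

/-- The limit as `α → 1` of the Gamma quotient in the multipliers of the fractional operator. -/
theorem Real.tendsto_Gamma_add_div_Gamma_sub {c : ℝ} (hc : 1 < c) :
    Tendsto (fun α : ℝ => Real.Gamma ((c + α) / 2) / Real.Gamma ((c - α - 2) / 2)) (nhds 1)
      (nhds ((c - 1) / 2 * ((c - 3) / 2))) := by
  have h1 : ContinuousAt (fun α : ℝ => Real.Gamma ((c + α) / 2)) 1 :=
    ContinuousAt.comp (f := fun α : ℝ => (c + α) / 2)
      (Real.continuousAt_Gamma_of_pos (by linarith)) (by fun_prop)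
  have h2 : Continuous fun α : ℝ => (Real.Gamma ((c - α - 2) / 2))⁻¹ :=
    Real.continuous_inv_Gamma.comp (g := fun s : ℝ => (Real.Gamma s)⁻¹)
      (f := fun α : ℝ => (c - α - 2) / 2) (by fun_prop)
  have h3 := (h1.mul h2.continuousAt).tendsto
  have h4 := Real.Gamma_add_two_div_Gamma (x := (c - 3) / 2) (by linarith)
  rw [show (c - 1) / 2 * ((c - 3) / 2) =
    Real.Gamma ((c + 1) / 2) * (Real.Gamma ((c - 1 - 2) / 2))⁻¹ from ?_]
  · exact h3
  rw [← div_eq_mul_inv, show (c + 1) / 2 = (c - 3) / 2 + 2 by ring,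
    show (c - 1 - 2) / 2 = (c - 3) / 2 by ring, h4]
  ring

theorem stmt6 (N : ℕ) (hN : 2 ≤ N) (k : ℕ) :
    Tendsto
      (fun α : ℝ =>
        2 * ((1 - α) * Real.Gamma (((N : ℝ) + 1) / 2) /
              (((N : ℝ) - 1) * Real.pi ^ (((N : ℝ) - 1) / 2))) *
          ((Real.pi ^ (((N : ℝ) - 1) / 2) * Real.Gamma ((1 - α) / 2) /
              ((1 + α) * (2 : ℝ) ^ α * Real.Gamma (((N : ℝ) + α) / 2))) *
            (Real.Gamma ((2 * (k : ℝ) + (N : ℝ) + α) / 2) /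
                Real.Gamma ((2 * (k : ℝ) + (N : ℝ) - α - 2) / 2) -
              Real.Gamma (((N : ℝ) + α) / 2) / Real.Gamma (((N : ℝ) - α - 2) / 2))))
      (nhdsWithin 1 (Set.Ioo (0 : ℝ) 1))
      (nhds ((k : ℝ) * ((k : ℝ) + (N : ℝ) - 2) / ((N : ℝ) - 1))) := by
  have hN' : (2 : ℝ) ≤ N := by exact_mod_cast hN
  have hk : (0 : ℝ) ≤ k := k.cast_nonneg
  have hpos : 0 < Real.Gamma (((N : ℝ) + 1) / 2) := Real.Gamma_pos_of_pos (by linarith)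
  have hN1 : (N : ℝ) - 1 ≠ 0 := by linarith
  have hbr := (Real.tendsto_Gamma_add_div_Gamma_sub (c := 2 * (k : ℝ) + N) (by linarith)).sub
    (Real.tendsto_Gamma_add_div_Gamma_sub (c := (N : ℝ)) (by linarith))
  have hnum : ContinuousAt (fun α : ℝ => Real.Gamma ((1 - α) / 2 + 1)) 1 :=
    ContinuousAt.comp (f := fun α : ℝ => (1 - α) / 2 + 1)
      (Real.continuousAt_Gamma_of_pos (by norm_num)) (by fun_prop)
  have hden : ContinuousAt (fun α : ℝ => Real.Gamma (((N : ℝ) + α) / 2)) 1 :=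
    ContinuousAt.comp (f := fun α : ℝ => ((N : ℝ) + α) / 2)
      (Real.continuousAt_Gamma_of_pos (by linarith)) (by fun_prop)
  have hpow : ContinuousAt (fun α : ℝ => (1 + α) * (2 : ℝ) ^ α) 1 :=
    (continuousAt_const.add continuousAt_id).mul
      (Real.continuousAt_const_rpow (by norm_num))
  have hpre : ContinuousAt (fun α : ℝ => 4 * Real.Gamma (((N : ℝ) + 1) / 2) *
      Real.Gamma ((1 - α) / 2 + 1) /
        (((N : ℝ) - 1) * ((1 + α) * (2 : ℝ) ^ α * Real.Gamma (((N : ℝ) + α) / 2)))) 1 := by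
    refine (continuousAt_const.mul hnum).div (continuousAt_const.mul (hpow.mul hden)) ?_
    exact mul_ne_zero hN1 (mul_ne_zero (by norm_num) hpos.ne')
  have hlim := (hpre.tendsto.mul hbr).mono_left (nhdsWithin_le_nhds (s := Set.Ioo (0 : ℝ) 1))
  have hval : 4 * Real.Gamma (((N : ℝ) + 1) / 2) * Real.Gamma ((1 - 1) / 2 + 1) /
        (((N : ℝ) - 1) * ((1 + 1) * (2 : ℝ) ^ (1 : ℝ) * Real.Gamma (((N : ℝ) + 1) / 2))) *
      ((2 * (k : ℝ) + N - 1) / 2 * ((2 * (k : ℝ) + N - 3) / 2) -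
        ((N : ℝ) - 1) / 2 * (((N : ℝ) - 3) / 2)) =
      (k : ℝ) * ((k : ℝ) + (N : ℝ) - 2) / ((N : ℝ) - 1) := by
    rw [sub_self, zero_div, zero_add, Real.Gamma_one, Real.rpow_one]
    field_simp
    ring
  rw [hval] at hlim
  refine hlim.congr' ?_
  filter_upwards [self_mem_nhdsWithin] with α hα
  have hα1 : (1 - α) / 2 ≠ 0 := by linarith [hα.2]
  have hpi : Real.pi ^ (((N : ℝ) - 1) / 2) ≠ 0 := (Real.rpow_pos_of_pos Real.pi_pos _).ne'
  rw [Real.Gamma_add_one hα1, ← mul_assoc (2 * _)]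
  congr 1
  have h1 : 1 + α ≠ 0 := by linarith [hα.1]
  have h2 : (2 : ℝ) ^ α ≠ 0 := (Real.rpow_pos_of_pos two_pos _).ne'
  have h3 : Real.Gamma (((N : ℝ) + α) / 2) ≠ 0 :=
    (Real.Gamma_pos_of_pos (by linarith [hα.1])).ne'
  generalize Real.Gamma ((1 - α) / 2) = g
  generalize Real.Gamma (((N : ℝ) + α) / 2) = g' at *
  generalize Real.Gamma (((N : ℝ) + 1) / 2) = g''
  generalize Real.pi ^ (((N : ℝ) - 1) / 2) = p at *
  generalize (2 : ℝ) ^ α = q at *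
  field_simp
  ring
end

section
/- Let N ≥ 2, α ∈ (0,1), θ ∈ S, and p ∈ ℝ^N with p ≠ 0. Define γ(τ) = ∫_B |τ(y−θ) + p|^{−(N+α)} dy for |τ| < |p|/2 (the integrand is well defined and smooth there since |y−θ| ≤ 2 on B). Then γ is twice differentiable at 0 with: γ(0) = |B| |p|^{−(N+α)}; γ'(0) = (N+α) |B| (p·θ) |p|^{−(N+α+2)}; and γ''(0) = (N+α)(N+α+2) |B| (p·θ)² |p|^{−(N+α+4)} − ((N+α)(N−α)/(N+2)) |B| |p|^{−(N+α+2)}. -/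
open MeasureTheory
open scoped RealInnerProductSpace

/-- Differentiation under the integral sign over a ball, for jointly continuous integrands. -/
theorem hasDerivAt_integral_ball {E : Type*} [NormedAddCommGroup E] [ProperSpace E]
    [MeasurableSpace E] [BorelSpace E] (μ : Measure E) [IsFiniteMeasureOnCompacts μ]
    {F F' : ℝ → E → ℝ} {R ρ : ℝ}
    (hF : ContinuousOn (Function.uncurry F) (Metric.closedBall 0 R ×ˢ Metric.closedBall 0 ρ))
    (hF' : ContinuousOn (Function.uncurry F') (Metric.closedBall 0 R ×ˢ Metric.closedBall 0 ρ))
    (hd : ∀ τ ∈ Metric.ball (0 : ℝ) R, ∀ y ∈ Metric.ball (0 : E) ρ,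
      HasDerivAt (fun t => F t y) (F' τ y) τ)
    {τ : ℝ} (hτ : τ ∈ Metric.ball (0 : ℝ) R) :
    HasDerivAt (fun t => ∫ y in Metric.ball (0 : E) ρ, F t y ∂μ)
      (∫ y in Metric.ball (0 : E) ρ, F' τ y ∂μ) τ := by
  obtain ⟨C, hC⟩ := ((isCompact_closedBall (0 : ℝ) R).prod
    (isCompact_closedBall (0 : E) ρ)).exists_bound_of_continuousOn hF'
  have slice : ∀ {G : ℝ → E → ℝ}, ContinuousOn (Function.uncurry G)
      (Metric.closedBall 0 R ×ˢ Metric.closedBall 0 ρ) → ∀ t ∈ Metric.ball (0 : ℝ) R,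
      IntegrableOn (G t) (Metric.ball 0 ρ) μ := by
    intro G hG t ht
    have h : ContinuousOn (G t) (Metric.closedBall 0 ρ) :=
      hG.comp (f := fun y => (t, y)) (by fun_prop)
        fun y hy => ⟨Metric.ball_subset_closedBall ht, hy⟩
    exact (h.integrableOn_compact (isCompact_closedBall _ _)).mono_set
      Metric.ball_subset_closedBall
  refine (hasDerivAt_integral_of_dominated_loc_of_deriv_le (bound := fun _ => C)
    (Metric.isOpen_ball.mem_nhds hτ) ?_ (slice hF τ hτ)
    (slice hF' τ hτ).aestronglyMeasurable ?_ ?_ ?_).2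
  · filter_upwards [Metric.isOpen_ball.mem_nhds hτ] with t ht
    exact (slice hF t ht).aestronglyMeasurable
  · filter_upwards [ae_restrict_mem Metric.isOpen_ball.measurableSet] with y hy t ht
    exact hC (t, y) ⟨Metric.ball_subset_closedBall ht, Metric.ball_subset_closedBall hy⟩
  · have : IsFiniteMeasure (μ.restrict (Metric.ball (0 : E) ρ)) :=
      ⟨by simpa using measure_ball_lt_top⟩
    exact integrable_const C
  · filter_upwards [ae_restrict_mem Metric.isOpen_ball.measurableSet] with y hy t ht
    exact hd t ht y hy

section Derivatives

variable {E : Type*} [NormedAddCommGroup E] [InnerProductSpace ℝ E]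

theorem hasDerivAt_norm_smul_add_rpow (a τ : ℝ) (v p : E) (h : τ • v + p ≠ 0) :
    HasDerivAt (fun t : ℝ => ‖t • v + p‖ ^ (-a))
      (-a * ⟪τ • v + p, v⟫ * ‖τ • v + p‖ ^ (-(a + 2))) τ := by
  have hw : 0 < ‖τ • v + p‖ := norm_pos_iff.mpr h
  have hl : HasDerivAt (fun t : ℝ => t • v + p) v τ := by
    simpa using ((hasDerivAt_id τ).smul_const v).add_const p
  have hr := hl.norm_sq.rpow_const (p := -a / 2) (Or.inl (by positivity))
  have e : ∀ x b : ℝ, 0 ≤ x → (x ^ 2) ^ b = x ^ (2 * b) := fun x b hx => by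
    rw [← Real.rpow_natCast, ← Real.rpow_mul hx]; norm_num
  convert hr using 1
  · ext t
    rw [e _ _ (norm_nonneg _)]
    ring_nf
  · rw [e _ _ hw.le, show 2 * (-a / 2 - 1) = -(a + 2) by ring]
    ring

theorem hasDerivAt_inner_smul_add_mul_norm_rpow (a τ : ℝ) (v p : E) (h : τ • v + p ≠ 0) :
    HasDerivAt (fun t : ℝ => -a * ⟪t • v + p, v⟫ * ‖t • v + p‖ ^ (-(a + 2)))
      (a * (a + 2) * ⟪τ • v + p, v⟫ ^ 2 * ‖τ • v + p‖ ^ (-(a + 4))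
        - a * ‖v‖ ^ 2 * ‖τ • v + p‖ ^ (-(a + 2))) τ := by
  have hl : HasDerivAt (fun t : ℝ => t • v + p) v τ := by
    simpa using ((hasDerivAt_id τ).smul_const v).add_const p
  have hi := (hl.inner ℝ (hasDerivAt_const τ v)).const_mul (-a)
  refine (hi.mul (hasDerivAt_norm_smul_add_rpow (a + 2) τ v p h)).congr_deriv ?_
  rw [show a + 2 + 2 = a + 4 by ring]
  simp only [inner_zero_right, real_inner_self_eq_norm_sq]
  ring

end Derivatives

section Moments

variable {E : Type*} [NormedAddCommGroup E] [InnerProductSpace ℝ E] [FiniteDimensional ℝ E]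
  [MeasurableSpace E] [BorelSpace E]

theorem setIntegral_ball_comp_linearIsometryEquiv (e : E ≃ₗᵢ[ℝ] E) (f : E → ℝ) (r : ℝ) :
    ∫ y in Metric.ball (0 : E) r, f (e y) = ∫ y in Metric.ball (0 : E) r, f y := by
  have h := e.measurePreserving.setIntegral_preimage_emb
    e.toMeasurableEquiv.measurableEmbedding f (Metric.ball 0 r)
  simpa using h

theorem setIntegral_ball_inner (u : E) (r : ℝ) :
    ∫ y in Metric.ball (0 : E) r, ⟪y, u⟫ = 0 := by
  have h := setIntegral_ball_comp_linearIsometryEquiv (LinearIsometryEquiv.neg ℝ)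
    (fun y : E => ⟪y, u⟫) r
  simp only [LinearIsometryEquiv.coe_neg, inner_neg_left, integral_neg] at h
  linarith

theorem integrableOn_ball_of_continuous {f : E → ℝ} (hf : Continuous f) (r : ℝ) :
    IntegrableOn f (Metric.ball 0 r) :=
  (hf.continuousOn.integrableOn_compact (isCompact_closedBall 0 r)).mono_set
    Metric.ball_subset_closedBall

theorem setIntegral_ball_inner_sq_congr {u v : E} (huv : ‖u‖ = ‖v‖) (r : ℝ) :
    ∫ y in Metric.ball (0 : E) r, ⟪y, u⟫ ^ 2 = ∫ y in Metric.ball (0 : E) r, ⟪y, v⟫ ^ 2 := by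
  have h := setIntegral_ball_comp_linearIsometryEquiv (Submodule.reflection (ℝ ∙ (u - v))ᗮ)
    (fun y : E => ⟪y, v⟫ ^ 2) r
  rw [← h]
  congr 1 with y
  rw [← LinearIsometryEquiv.inner_map_map (Submodule.reflection (ℝ ∙ (u - v))ᗮ) y u,
    Submodule.reflection_sub huv]

theorem finrank_mul_setIntegral_ball_inner_sq (u : E) (r : ℝ) :
    Module.finrank ℝ E * ∫ y in Metric.ball (0 : E) r, ⟪y, u⟫ ^ 2 =
      ‖u‖ ^ 2 * ∫ y in Metric.ball (0 : E) r, ‖y‖ ^ 2 := by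
  have b := stdOrthonormalBasis ℝ E
  have h : ∀ y : E, ‖y‖ ^ 2 = ∑ i, ⟪y, b i⟫ ^ 2 := fun y => by
    rw [← b.sum_sq_norm_inner_left y]; simp
  simp_rw [h]
  rw [integral_finsetSum _ fun i _ => integrableOn_ball_of_continuous (by fun_prop) r,
    Finset.mul_sum]
  have hi : ∀ i, ‖u‖ ^ 2 * ∫ y in Metric.ball (0 : E) r, ⟪y, b i⟫ ^ 2 =
      ∫ y in Metric.ball (0 : E) r, ⟪y, u⟫ ^ 2 := fun i => by
    rw [setIntegral_ball_inner_sq_congr (u := u) (v := ‖u‖ • b i) (by simp [norm_smul]),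
      ← integral_const_mul]
    congr 1 with y
    rw [inner_smul_right]
    ring
  rw [← h]
  simp [hi]

theorem setIntegral_unitBall_norm_sq [Nontrivial E] :
    ∫ y in Metric.ball (0 : E) 1, ‖y‖ ^ 2 =
      Module.finrank ℝ E / (Module.finrank ℝ E + 2) * volume.real (Metric.ball (0 : E) 1) := by
  have hl : ∫ y in Metric.ball (0 : E) 1, ‖y‖ ^ 2 =
      ∫ y : E, (Set.Iio (1 : ℝ)).indicator (fun x => x ^ 2) ‖y‖ := by
    rw [← integral_indicator Metric.isOpen_ball.measurableSet]
    congr 1 with y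
    by_cases hy : ‖y‖ < 1 <;> simp [hy]
  have hn : 0 < Module.finrank ℝ E := Module.finrank_pos
  have hr : ∫ x in Set.Ioi (0 : ℝ), x ^ (Module.finrank ℝ E - 1) •
      (Set.Iio (1 : ℝ)).indicator (fun x => x ^ 2) x = ∫ x in (0 : ℝ)..1,
        x ^ (Module.finrank ℝ E + 1) := by
    rw [intervalIntegral.integral_of_le zero_le_one, integral_Ioc_eq_integral_Ioo,
      ← Set.Ioi_inter_Iio, Set.inter_comm, ← Measure.restrict_restrict measurableSet_Iio,
      ← integral_indicator measurableSet_Iio]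
    congr 1 with x
    by_cases hx : x < 1
    · simp [hx, ← pow_add, show Module.finrank ℝ E - 1 + 2 = Module.finrank ℝ E + 1 by omega]
    · simp [hx]
  rw [hl, integral_fun_norm_addHaar, hr, integral_pow]
  simp only [nsmul_eq_mul, smul_eq_mul]
  push_cast
  have : (Module.finrank ℝ E : ℝ) + 2 ≠ 0 := by positivity
  have : (Module.finrank ℝ E : ℝ) + 1 + 1 ≠ 0 := by positivity
  simp
  field_simp
  ring

end Moments

theorem stmt12 (N : ℕ) (hN : 2 ≤ N) (α : ℝ) (hα : α ∈ Set.Ioo (0 : ℝ) 1)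
    (θ : EuclideanSpace ℝ (Fin N)) (hθ : θ ∈ Metric.sphere (0 : EuclideanSpace ℝ (Fin N)) 1)
    (p : EuclideanSpace ℝ (Fin N)) (hp : p ≠ 0) :
    let γ : ℝ → ℝ := fun τ =>
      ∫ y in Metric.ball (0 : EuclideanSpace ℝ (Fin N)) 1,
        ‖τ • (y - θ) + p‖ ^ (-((N : ℝ) + α))
    let volB : ℝ := (volume (Metric.ball (0 : EuclideanSpace ℝ (Fin N)) 1)).toReal
    γ 0 = volB * ‖p‖ ^ (-((N : ℝ) + α)) ∧
    HasDerivAt γ (((N : ℝ) + α) * volB * ⟪p, θ⟫ * ‖p‖ ^ (-((N : ℝ) + α + 2))) 0 ∧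
    HasDerivAt (deriv γ)
      (((N : ℝ) + α) * ((N : ℝ) + α + 2) * volB * ⟪p, θ⟫ ^ 2 * ‖p‖ ^ (-((N : ℝ) + α + 4)) -
        ((N : ℝ) + α) * ((N : ℝ) - α) / ((N : ℝ) + 2) * volB * ‖p‖ ^ (-((N : ℝ) + α + 2))) 0 := by
  intro γ volB
  have hp0 : 0 < ‖p‖ := norm_pos_iff.mpr hp
  have hθ1 : ‖θ‖ = 1 := by simpa using hθ
  set s : ℝ := (N : ℝ) + α
  set D : Set (ℝ × EuclideanSpace ℝ (Fin N)) :=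
    Metric.closedBall 0 (‖p‖ / 4) ×ˢ Metric.closedBall 0 1
  have hne : ∀ x ∈ D, x.1 • (x.2 - θ) + p ≠ 0 := by
    rintro ⟨t, y⟩ ⟨ht, hy⟩ h
    simp only [mem_closedBall_zero_iff] at ht hy
    have h1 : ‖p‖ = ‖t‖ * ‖y - θ‖ := by
      rw [← norm_smul, eq_neg_of_add_eq_zero_left h, norm_neg]
    have h2 : ‖y - θ‖ ≤ 2 := (norm_sub_le y θ).trans (by linarith)
    nlinarith [norm_nonneg (y - θ), norm_nonneg t]
  have hmem : ∀ t ∈ Metric.ball (0 : ℝ) (‖p‖ / 4),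
      ∀ y ∈ Metric.ball (0 : EuclideanSpace ℝ (Fin N)) 1,
      t • (y - θ) + p ≠ 0 := fun t ht y hy =>
    hne (t, y) ⟨Metric.ball_subset_closedBall ht, Metric.ball_subset_closedBall hy⟩
  have hpow : ∀ a : ℝ, ContinuousOn
      (fun x : ℝ × EuclideanSpace ℝ (Fin N) => ‖x.1 • (x.2 - θ) + p‖ ^ a) D := fun a =>
    ContinuousOn.rpow_const (by fun_prop) fun x hx => Or.inl (norm_ne_zero_iff.mpr (hne x hx))
  set F₁ : ℝ → EuclideanSpace ℝ (Fin N) → ℝ := fun t y =>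
    -s * ⟪t • (y - θ) + p, y - θ⟫ * ‖t • (y - θ) + p‖ ^ (-(s + 2)) with hF₁
  set F₂ : ℝ → EuclideanSpace ℝ (Fin N) → ℝ := fun t y =>
    s * (s + 2) * ⟪t • (y - θ) + p, y - θ⟫ ^ 2 * ‖t • (y - θ) + p‖ ^ (-(s + 4))
      - s * ‖y - θ‖ ^ 2 * ‖t • (y - θ) + p‖ ^ (-(s + 2)) with hF₂
  have hc₁ : ContinuousOn (Function.uncurry F₁) D :=
    ContinuousOn.mul (by fun_prop) (hpow _)
  have hc₂ : ContinuousOn (Function.uncurry F₂) D :=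
    (ContinuousOn.mul (by fun_prop) (hpow _)).sub (ContinuousOn.mul (by fun_prop) (hpow _))
  have h0 : (0 : ℝ) ∈ Metric.ball (0 : ℝ) (‖p‖ / 4) := Metric.mem_ball_self (by positivity)
  have hd₁ : ∀ t ∈ Metric.ball (0 : ℝ) (‖p‖ / 4), HasDerivAt γ
      (∫ y in Metric.ball (0 : EuclideanSpace ℝ (Fin N)) 1, F₁ t y) t := fun t ht =>
    hasDerivAt_integral_ball volume (hpow (-s)) hc₁
      (fun t ht y hy => hasDerivAt_norm_smul_add_rpow s t (y - θ) p (hmem t ht y hy)) ht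
  have hd₂ := hasDerivAt_integral_ball volume hc₁ hc₂
      (fun t ht y hy => hasDerivAt_inner_smul_add_mul_norm_rpow s t (y - θ) p (hmem t ht y hy)) h0
  have : Nontrivial (EuclideanSpace ℝ (Fin N)) := ⟨p, 0, hp⟩
  have hsq := setIntegral_unitBall_norm_sq (E := EuclideanSpace ℝ (Fin N))
  have hinp := finrank_mul_setIntegral_ball_inner_sq p 1
  have hlin := fun u : EuclideanSpace ℝ (Fin N) => setIntegral_ball_inner u 1
  have hint := fun {f : EuclideanSpace ℝ (Fin N) → ℝ} (hf : Continuous f) =>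
    integrableOn_ball_of_continuous hf 1
  have hconst : ∀ c : ℝ, ∫ _ in Metric.ball (0 : EuclideanSpace ℝ (Fin N)) 1, c = volB * c :=
    fun c => by simp [volB, Measure.real]
  rw [finrank_euclideanSpace_fin] at hsq hinp
  have hN0 : (N : ℝ) ≠ 0 := by positivity
  have hN2 : (N : ℝ) + 2 ≠ 0 := by positivity
  refine ⟨?_, (hd₁ 0 h0).congr_deriv ?_, (hd₂.congr_of_eventuallyEq ?_).congr_deriv ?_⟩
  · simp only [γ, zero_smul, zero_add, hconst]
    rfl
  · have e : ∀ y, F₁ 0 y = -s * ‖p‖ ^ (-(s + 2)) * ⟪y, p⟫ + s * ‖p‖ ^ (-(s + 2)) * ⟪p, θ⟫ :=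
      fun y => by
        simp only [hF₁, zero_smul, zero_add, inner_sub_right, real_inner_comm p y]
        ring
    simp_rw [e]
    rw [integral_add (hint (by fun_prop)) (hint (by fun_prop)), integral_const_mul, hlin, hconst]
    ring
  · filter_upwards [Metric.isOpen_ball.mem_nhds h0] with t ht
    exact (hd₁ t ht).deriv
  · have e : ∀ y, F₂ 0 y = s * (s + 2) * ‖p‖ ^ (-(s + 4)) * ⟪y, p⟫ ^ 2
        + (-2 * s * (s + 2) * ⟪p, θ⟫ * ‖p‖ ^ (-(s + 4))) * ⟪y, p⟫
        + 2 * s * ‖p‖ ^ (-(s + 2)) * ⟪y, θ⟫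
        + (-s * ‖p‖ ^ (-(s + 2))) * ‖y‖ ^ 2
        + (s * (s + 2) * ⟪p, θ⟫ ^ 2 * ‖p‖ ^ (-(s + 4)) - s * ‖p‖ ^ (-(s + 2))) := fun y => by
      simp only [hF₂, zero_smul, zero_add, inner_sub_right, real_inner_comm p y,
        norm_sub_sq_real, hθ1]
      ring
    simp_rw [e]
    rw [integral_add (hint (by fun_prop)) (hint (by fun_prop)),
      integral_add (hint (by fun_prop)) (hint (by fun_prop)),
      integral_add (hint (by fun_prop)) (hint (by fun_prop)),
      integral_add (hint (by fun_prop)) (hint (by fun_prop)),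
      integral_const_mul, integral_const_mul, integral_const_mul, integral_const_mul,
      hlin, hlin, hconst]
    have hinp' : ∫ y in Metric.ball (0 : EuclideanSpace ℝ (Fin N)) 1, ⟪y, p⟫ ^ 2 =
        ‖p‖ ^ 2 * (volB / (N + 2)) := by
      rw [hsq] at hinp
      apply mul_left_cancel₀ hN0
      rw [hinp]
      simp only [volB, Measure.real]
      field_simp
    have hp2 : ‖p‖ ^ (-(s + 2)) = ‖p‖ ^ (-(s + 4)) * ‖p‖ ^ 2 := by
      rw [← Real.rpow_natCast, ← Real.rpow_add hp0]
      congr 1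
      push_cast
      ring
    rw [hinp', hsq, hp2]
    change _ + _ * (_ * volB) + _ = _
    simp only [s]
    field_simp
    ring
end

section
/- Let N ≥ 2, β ∈ (0,1), e ∈ S, and let θ ↦ R_θ be a map from S into the orthogonal group of ℝ^N satisfying R_θ e = θ for all θ ∈ S_e := {θ ∈ S : θ·e ≥ 0} and ‖R_{θ₁} − R_{θ₂}‖ ≤ L |θ₁−θ₂| for all θ₁, θ₂ ∈ S, for some L > 0. Then there exists a constant C > 0, depending only on N, β and L, with the following property. For i = 1, 2, let ψ_i : ℝ^N → ℝ be differentiable with sup_{x} |∇ψ_i(x)| ≤ A_i and |∇ψ_i(x) − ∇ψ_i(y)| ≤ A_i |x−y|^β for all x, y, and define Λ₂(σ,θ) = (ψ₁(θ) − ψ₁(σ))(ψ₂(θ) − ψ₂(σ)). Then for all σ ∈ S and θ, θ₁, θ₂ ∈ S_e: (i) |Λ₂(R_θ σ, θ)| ≤ C A₁ A₂ |e−σ|², and (ii) |Λ₂(R_{θ₁} σ, θ₁) − Λ₂(R_{θ₂} σ, θ₂)| ≤ C A₁ A₂ |e−σ|² |θ₁−θ₂|^β. -/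
open scoped RealInnerProductSpace

section HolderGradient

variable {E : Type*} [NormedAddCommGroup E] [InnerProductSpace ℝ E] [CompleteSpace E]

theorem norm_fderiv_eq_norm_gradient (f : E → ℝ) (x : E) : ‖fderiv ℝ f x‖ = ‖gradient f x‖ := by
  simp [gradient]

theorem norm_fderiv_sub_eq_norm_gradient_sub (f : E → ℝ) (x y : E) :
    ‖fderiv ℝ f x - fderiv ℝ f y‖ = ‖gradient f x - gradient f y‖ := by
  rw [gradient, gradient, ← map_sub, LinearIsometryEquiv.norm_map]

/-- A function with bounded gradient is Lipschitz. -/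
theorem abs_sub_le_of_norm_gradient_le {f : E → ℝ} {A : ℝ} (hf : Differentiable ℝ f)
    (hA : ∀ x, ‖gradient f x‖ ≤ A) (x y : E) : |f x - f y| ≤ A * ‖x - y‖ := by
  simpa only [Real.norm_eq_abs] using
    convex_univ.norm_image_sub_le_of_norm_fderiv_le (𝕜 := ℝ) (fun z _ => hf z)
      (fun z _ => (norm_fderiv_eq_norm_gradient f z).trans_le (hA z))
      (Set.mem_univ y) (Set.mem_univ x)

/-- Increments of a function with Hölder gradient, composed with two linear isometries `S`, `T`
and taken between two points of the unit ball, differ by a quantity controlled by `‖S - T‖`. -/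
theorem abs_increment_comp_sub_le {f : E → ℝ} {A β δ : ℝ} (hβ : 0 ≤ β) (hf : Differentiable ℝ f)
    (hA : ∀ x, ‖gradient f x‖ ≤ A)
    (hH : ∀ x y, ‖gradient f x - gradient f y‖ ≤ A * ‖x - y‖ ^ β) (S T : E →ₗᵢ[ℝ] E)
    (hST : ‖S.toContinuousLinearMap - T.toContinuousLinearMap‖ ≤ δ)
    {x y : E} (hx : ‖x‖ ≤ 1) (hy : ‖y‖ ≤ 1) :
    |(f (S x) - f (S y)) - (f (T x) - f (T y))| ≤ A * (δ ^ β + δ) * ‖x - y‖ := by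
  have hA0 : 0 ≤ A := (norm_nonneg _).trans (hA 0)
  have hδ : 0 ≤ δ := (norm_nonneg _).trans hST
  have hderiv (z : E) : HasFDerivAt (fun z => f (S z) - f (T z))
      ((fderiv ℝ f (S z)).comp S.toContinuousLinearMap -
        (fderiv ℝ f (T z)).comp T.toContinuousLinearMap) z :=
    ((hf (S z)).hasFDerivAt.comp z S.toContinuousLinearMap.hasFDerivAt).sub
      ((hf (T z)).hasFDerivAt.comp z T.toContinuousLinearMap.hasFDerivAt)
  have hbound (z : E) (hz : z ∈ Metric.closedBall (0 : E) 1) :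
      ‖(fderiv ℝ f (S z)).comp S.toContinuousLinearMap -
        (fderiv ℝ f (T z)).comp T.toContinuousLinearMap‖ ≤ A * (δ ^ β + δ) := by
    have hz1 : ‖z‖ ≤ 1 := mem_closedBall_zero_iff.mp hz
    have hdist : ‖S z - T z‖ ≤ δ :=
      ((S.toContinuousLinearMap - T.toContinuousLinearMap).le_of_opNorm_le hST z).trans
        (mul_le_of_le_one_right hδ hz1)
    have hsplit : (fderiv ℝ f (S z)).comp S.toContinuousLinearMap -
        (fderiv ℝ f (T z)).comp T.toContinuousLinearMap =
        (fderiv ℝ f (S z) - fderiv ℝ f (T z)).comp S.toContinuousLinearMap +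
        (fderiv ℝ f (T z)).comp (S.toContinuousLinearMap - T.toContinuousLinearMap) := by
      rw [ContinuousLinearMap.sub_comp, ContinuousLinearMap.comp_sub]; abel
    have h₁ : ‖(fderiv ℝ f (S z) - fderiv ℝ f (T z)).comp S.toContinuousLinearMap‖ ≤
        A * δ ^ β := by
      refine (ContinuousLinearMap.opNorm_comp_le _ _).trans
        ((mul_le_of_le_one_right (norm_nonneg _) S.norm_toContinuousLinearMap_le).trans ?_)
      rw [norm_fderiv_sub_eq_norm_gradient_sub]
      exact (hH _ _).trans (by gcongr)
    have h₂ : ‖(fderiv ℝ f (T z)).comp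
        (S.toContinuousLinearMap - T.toContinuousLinearMap)‖ ≤ A * δ := by
      refine (ContinuousLinearMap.opNorm_comp_le _ _).trans ?_
      rw [norm_fderiv_eq_norm_gradient]
      exact mul_le_mul (hA _) hST (norm_nonneg _) hA0
    rw [hsplit, mul_add]
    exact (norm_add_le _ _).trans (add_le_add h₁ h₂)
  have hmain := (convex_closedBall (0 : E) 1).norm_image_sub_le_of_norm_hasFDerivWithin_le
    (fun z _ => (hderiv z).hasFDerivWithinAt) hbound
    (mem_closedBall_zero_iff.mpr hy) (mem_closedBall_zero_iff.mpr hx)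
  rw [Real.norm_eq_abs] at hmain
  convert hmain using 2
  ring

end HolderGradient

theorem le_two_mul_rpow {d β : ℝ} (hβ₀ : 0 ≤ β) (hβ₁ : β ≤ 1) (hd₀ : 0 ≤ d) (hd₂ : d ≤ 2) :
    d ≤ 2 * d ^ β := by
  rcases le_total d 1 with h | h
  · have := Real.self_le_rpow_of_le_one hd₀ h hβ₁
    linarith [Real.rpow_nonneg hd₀ β]
  · linarith [Real.one_le_rpow h hβ₀]

theorem rpow_le_one_add {a β : ℝ} (hβ₀ : 0 ≤ β) (hβ₁ : β ≤ 1) (ha : 0 ≤ a) :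
    a ^ β ≤ 1 + a := by
  rcases le_total a 1 with h | h
  · linarith [Real.rpow_le_one ha h hβ₀]
  · linarith [Real.rpow_le_self_of_one_le h hβ₁]

theorem stmt18 (N : ℕ) (hN : 2 ≤ N) (β : ℝ) (hβ : β ∈ Set.Ioo (0 : ℝ) 1)
    (L : ℝ) (hL : 0 < L) :
    ∃ C : ℝ, 0 < C ∧
      ∀ e ∈ Metric.sphere (0 : EuclideanSpace ℝ (Fin N)) 1,
      ∀ R : EuclideanSpace ℝ (Fin N) →
          (EuclideanSpace ℝ (Fin N) →ₗᵢ[ℝ] EuclideanSpace ℝ (Fin N)),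
        (∀ θ ∈ Metric.sphere (0 : EuclideanSpace ℝ (Fin N)) 1, 0 ≤ ⟪θ, e⟫ → R θ e = θ) →
        (∀ θ₁ ∈ Metric.sphere (0 : EuclideanSpace ℝ (Fin N)) 1,
          ∀ θ₂ ∈ Metric.sphere (0 : EuclideanSpace ℝ (Fin N)) 1,
            ‖(R θ₁).toContinuousLinearMap - (R θ₂).toContinuousLinearMap‖ ≤
              L * ‖θ₁ - θ₂‖) →
        ∀ (ψ₁ ψ₂ : EuclideanSpace ℝ (Fin N) → ℝ) (A₁ A₂ : ℝ),
          Differentiable ℝ ψ₁ → Differentiable ℝ ψ₂ →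
          (∀ x, ‖gradient ψ₁ x‖ ≤ A₁) → (∀ x, ‖gradient ψ₂ x‖ ≤ A₂) →
          (∀ x y, ‖gradient ψ₁ x - gradient ψ₁ y‖ ≤ A₁ * ‖x - y‖ ^ β) →
          (∀ x y, ‖gradient ψ₂ x - gradient ψ₂ y‖ ≤ A₂ * ‖x - y‖ ^ β) →
          (∀ σ ∈ Metric.sphere (0 : EuclideanSpace ℝ (Fin N)) 1,
            ∀ θ ∈ Metric.sphere (0 : EuclideanSpace ℝ (Fin N)) 1, 0 ≤ ⟪θ, e⟫ →
              |(ψ₁ θ - ψ₁ (R θ σ)) * (ψ₂ θ - ψ₂ (R θ σ))| ≤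
                C * A₁ * A₂ * ‖e - σ‖ ^ 2) ∧
          (∀ σ ∈ Metric.sphere (0 : EuclideanSpace ℝ (Fin N)) 1,
            ∀ θ₁ ∈ Metric.sphere (0 : EuclideanSpace ℝ (Fin N)) 1, 0 ≤ ⟪θ₁, e⟫ →
            ∀ θ₂ ∈ Metric.sphere (0 : EuclideanSpace ℝ (Fin N)) 1, 0 ≤ ⟪θ₂, e⟫ →
              |(ψ₁ θ₁ - ψ₁ (R θ₁ σ)) * (ψ₂ θ₁ - ψ₂ (R θ₁ σ)) -
                  (ψ₁ θ₂ - ψ₁ (R θ₂ σ)) * (ψ₂ θ₂ - ψ₂ (R θ₂ σ))| ≤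
                C * A₁ * A₂ * ‖e - σ‖ ^ 2 * ‖θ₁ - θ₂‖ ^ β) := by
  obtain ⟨hβ₀, hβ₁⟩ := hβ
  refine ⟨2 * (1 + 3 * L), by positivity, ?_⟩
  intro e he R hRe hRL ψ₁ ψ₂ A₁ A₂ hψ₁ hψ₂ hA₁ hA₂ hH₁ hH₂
  simp only [mem_sphere_zero_iff_norm] at *
  have hA₁0 : 0 ≤ A₁ := (norm_nonneg _).trans (hA₁ 0)
  have hA₂0 : 0 ≤ A₂ := (norm_nonneg _).trans (hA₂ 0)
  have hinc {ψ : EuclideanSpace ℝ (Fin N) → ℝ} {A : ℝ} (hψ : Differentiable ℝ ψ)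
      (hA : ∀ x, ‖gradient ψ x‖ ≤ A) {σ θ : EuclideanSpace ℝ (Fin N)} (hθ : ‖θ‖ = 1)
      (hθe : 0 ≤ ⟪θ, e⟫) : |ψ θ - ψ (R θ σ)| ≤ A * ‖e - σ‖ := by
    have h := abs_sub_le_of_norm_gradient_le hψ hA (R θ e) (R θ σ)
    rwa [← map_sub, LinearIsometry.norm_map, hRe θ hθ hθe] at h
  have hdiff {ψ : EuclideanSpace ℝ (Fin N) → ℝ} {A : ℝ} (hψ : Differentiable ℝ ψ)
      (hA : ∀ x, ‖gradient ψ x‖ ≤ A)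
      (hH : ∀ x y, ‖gradient ψ x - gradient ψ y‖ ≤ A * ‖x - y‖ ^ β)
      {σ θ₁ θ₂ : EuclideanSpace ℝ (Fin N)} (hσ : ‖σ‖ = 1) (hθ₁ : ‖θ₁‖ = 1)
      (hθ₁e : 0 ≤ ⟪θ₁, e⟫) (hθ₂ : ‖θ₂‖ = 1) (hθ₂e : 0 ≤ ⟪θ₂, e⟫) :
      |(ψ θ₁ - ψ (R θ₁ σ)) - (ψ θ₂ - ψ (R θ₂ σ))| ≤
        A * ((1 + 3 * L) * ‖θ₁ - θ₂‖ ^ β) * ‖e - σ‖ := by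
    have hA0 : 0 ≤ A := (norm_nonneg _).trans (hA 0)
    have h := abs_increment_comp_sub_le hβ₀.le hψ hA hH (R θ₁) (R θ₂)
      (hRL θ₁ hθ₁ θ₂ hθ₂) he.le hσ.le
    rw [hRe θ₁ hθ₁ hθ₁e, hRe θ₂ hθ₂ hθ₂e] at h
    refine h.trans ?_
    gcongr
    have hd : ‖θ₁ - θ₂‖ ≤ 2 := (norm_sub_le _ _).trans (by rw [hθ₁, hθ₂]; norm_num)
    have h₁ := mul_le_mul_of_nonneg_left
      (le_two_mul_rpow hβ₀.le hβ₁.le (norm_nonneg (θ₁ - θ₂)) hd) hL.le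
    have h₂ := mul_le_mul_of_nonneg_right (rpow_le_one_add hβ₀.le hβ₁.le hL.le)
      (Real.rpow_nonneg (norm_nonneg (θ₁ - θ₂)) β)
    rw [Real.mul_rpow hL.le (norm_nonneg _)]
    linarith
  refine ⟨fun σ _ θ hθ hθe => ?_, fun σ hσ θ₁ hθ₁ hθ₁e θ₂ hθ₂ hθ₂e => ?_⟩
  · rw [abs_mul]
    calc |ψ₁ θ - ψ₁ (R θ σ)| * |ψ₂ θ - ψ₂ (R θ σ)|
        ≤ (A₁ * ‖e - σ‖) * (A₂ * ‖e - σ‖) :=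
          mul_le_mul (hinc hψ₁ hA₁ hθ hθe) (hinc hψ₂ hA₂ hθ hθe) (abs_nonneg _) (by positivity)
      _ = 1 * (A₁ * A₂ * ‖e - σ‖ ^ 2) := by ring
      _ ≤ 2 * (1 + 3 * L) * (A₁ * A₂ * ‖e - σ‖ ^ 2) := by gcongr; linarith
      _ = 2 * (1 + 3 * L) * A₁ * A₂ * ‖e - σ‖ ^ 2 := by ring
  · have hsplit (a b c d : ℝ) : a * b - c * d = (a - c) * b + c * (b - d) := by ring
    rw [hsplit]
    refine (abs_add_le _ _).trans ?_
    rw [abs_mul, abs_mul]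
    have h₁ := mul_le_mul (hdiff hψ₁ hA₁ hH₁ hσ hθ₁ hθ₁e hθ₂ hθ₂e)
      (hinc hψ₂ hA₂ (σ := σ) hθ₁ hθ₁e) (abs_nonneg _) (by positivity)
    have h₂ := mul_le_mul (hinc hψ₁ hA₁ (σ := σ) hθ₂ hθ₂e)
      (hdiff hψ₂ hA₂ hH₂ hσ hθ₁ hθ₁e hθ₂ hθ₂e) (abs_nonneg _) (by positivity)
    refine (add_le_add h₁ h₂).trans_eq ?_
    ring
end
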